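/- Let f be a topologically transitive expanding Lorenz map with critical point c, with the convention f(c) = 0, and suppose f has no fixed points, i.e. f(0) ≠ 0 and f(1) ≠ 1. Then no proper closed subset of [0,1] is completely invariant: if E ⊆ [0,1] is nonempty, closed, and satisfies f(E) = E and f^{-1}(E) = E, then E = [0,1]. -/

import Mathlib

open Set Filter Topology Function

/-- `f` is an expanding Lorenz map on `[a,b]` with critical point `c`:
continuous and strictly increasing on `[a,c)` and `(c,b]`, with
`lim_{x→c⁻} f(x) = b`, `lim_{x→c⁺} f(x) = a`, and differentiable with
derivative uniformly greater than `1` outside a finite set. -/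
structure IsExpandingLorenzOn (f : ℝ → ℝ) (c a b : ℝ) : Prop where
  a_lt_c : a < c
  c_lt_b : c < b
  mapsTo : Set.MapsTo f (Set.Icc a b) (Set.Icc a b)
  mono_left : StrictMonoOn f (Set.Ico a c)
  mono_right : StrictMonoOn f (Set.Ioc c b)
  cont_left : ContinuousOn f (Set.Ico a c)
  cont_right : ContinuousOn f (Set.Ioc c b)
  lim_left : Filter.Tendsto f (nhdsWithin c (Set.Iio c)) (nhds b)
  lim_right : Filter.Tendsto f (nhdsWithin c (Set.Ioi c)) (nhds a)
  expanding : ∃ F : Set ℝ, F.Finite ∧ ∃ lam : ℝ, 1 < lam ∧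
    ∀ x ∈ Set.Icc a b \ F, ∃ d : ℝ, HasDerivWithinAt f d (Set.Icc a b) x ∧ lam ≤ d

/-- An expanding Lorenz map on `[0,1]` with critical point `c`. -/
def IsExpandingLorenz (f : ℝ → ℝ) (c : ℝ) : Prop := IsExpandingLorenzOn f c 0 1

/-- A primary `n(k)`-cycle `z 0 < z 1 < ⋯ < z (n-k-1) < c < z (n-k) < ⋯ < z (n-1)`
for a Lorenz map `f` with critical point `c`. -/
structure IsPrimaryCycle (f : ℝ → ℝ) (c : ℝ) (n k : ℕ) (z : ℕ → ℝ) : Prop where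
  k_pos : 0 < k
  k_lt_n : k < n
  coprime : Nat.Coprime n k
  mem : ∀ i < n, z i ∈ Set.Icc (0:ℝ) 1
  mono : ∀ i j : ℕ, i < j → j < n → z i < z j
  left_of_c : ∀ i < n - k, z i < c
  right_of_c : ∀ i : ℕ, n - k ≤ i → i < n → c < z i
  step : ∀ i < n, f (z i) = z ((i + k) % n)
  le_f0 : z (k - 1) ≤ f 0
  f1_le : f 1 ≤ z k

/-- `g` is a renormalization `(f^l, f^r)` of the Lorenz map `f` on the
renormalization interval `[u,v]`: on `[u,c)` (resp. `(c,v]`) the map `g`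
is given by `f^[l]` (resp. `f^[r]`), with values given by one-sided limits
at points where some earlier iterate hits `c`, and `g` is itself an
expanding Lorenz map on `[u,v]` with critical point `c`. -/
structure IsRenormalization (f : ℝ → ℝ) (c : ℝ) (l r : ℕ) (u v : ℝ) (g : ℝ → ℝ) : Prop where
  one_lt_l : 1 < l
  one_lt_r : 1 < r
  u_nonneg : 0 ≤ u
  u_lt_c : u < c
  c_lt_v : c < v
  v_le_one : v ≤ 1
  proper : 0 < u ∨ v < 1
  eq_left : ∀ x ∈ Set.Ico u c, (∀ i < l, f^[i] x ≠ c) → g x = f^[l] x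
  eq_right : ∀ x ∈ Set.Ioc c v, (∀ i < r, f^[i] x ≠ c) → g x = f^[r] x
  lim_left_pt : ∀ x ∈ Set.Ico u c,
    Filter.Tendsto (f^[l]) (nhdsWithin x (Set.Ioi x)) (nhds (g x))
  lim_right_pt : ∀ x ∈ Set.Ioc c v,
    Filter.Tendsto (f^[r]) (nhdsWithin x (Set.Iio x)) (nhds (g x))
  lim_c_left : Filter.Tendsto (f^[l]) (nhdsWithin c (Set.Iio c)) (nhds v)
  lim_c_right : Filter.Tendsto (f^[r]) (nhdsWithin c (Set.Ioi c)) (nhds u)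
  lorenz : IsExpandingLorenzOn g c u v

/-- The forward orbit of `x` enters the set `S` with a `c`-free prefix:
there is `n ≥ 0` with `f^[i] x ≠ c` for `0 ≤ i < n` and `f^[n] x ∈ S`. -/
def CFreeEnters (f : ℝ → ℝ) (c : ℝ) (S : Set ℝ) (x : ℝ) : Prop :=
  ∃ n : ℕ, (∀ i < n, f^[i] x ≠ c) ∧ f^[n] x ∈ S

/-- `N(U) = min {n ≥ 0 : f^[n] z = c for some z ∈ U}`. -/
noncomputable def hitTime (f : ℝ → ℝ) (c : ℝ) (U : Set ℝ) : ℕ :=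
  sInf {n : ℕ | ∃ z ∈ U, f^[n] z = c}

/-- `x ∈ [0,1]` is a `c`-free periodic point of `f` of (exact) period `p`. -/
def IsCFreePeriodic (f : ℝ → ℝ) (c x : ℝ) (p : ℕ) : Prop :=
  x ∈ Set.Icc (0:ℝ) 1 ∧ f^[p] x = x ∧ (∀ i : ℕ, 0 < i → i < p → f^[i] x ≠ x) ∧
    ∀ i < p, f^[i] x ≠ c

/-- Topological transitivity of `f` as a map of `[0,1]`. -/
def LorenzTransitive (f : ℝ → ℝ) : Prop :=
  ∀ U V : Set ℝ, IsOpen U → IsOpen V →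
    (U ∩ Set.Icc 0 1).Nonempty → (V ∩ Set.Icc 0 1).Nonempty →
    ∃ n : ℕ, (f^[n] '' (U ∩ Set.Icc 0 1) ∩ (V ∩ Set.Icc 0 1)).Nonempty

/-- `f` is locally eventually onto: every nonempty (relatively) open subset of `[0,1]`
contains open intervals mapped homeomorphically onto `(0,c)` and onto `(c,1)`
by suitable iterates of `f`. -/
def LocallyEventuallyOnto (f : ℝ → ℝ) (c : ℝ) : Prop :=
  ∀ U : Set ℝ, IsOpen U → (U ∩ Set.Icc 0 1).Nonempty →
    (∃ a b : ℝ, a < b ∧ Set.Ioo a b ⊆ U ∩ Set.Icc 0 1 ∧ ∃ n : ℕ,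
      ContinuousOn (f^[n]) (Set.Ioo a b) ∧ Set.InjOn (f^[n]) (Set.Ioo a b) ∧
        f^[n] '' Set.Ioo a b = Set.Ioo 0 c) ∧
    (∃ a b : ℝ, a < b ∧ Set.Ioo a b ⊆ U ∩ Set.Icc 0 1 ∧ ∃ n : ℕ,
      ContinuousOn (f^[n]) (Set.Ioo a b) ∧ Set.InjOn (f^[n]) (Set.Ioo a b) ∧
        f^[n] '' Set.Ioo a b = Set.Ioo c 1)

/-- The generalized backward orbit of `x`: points joined to `x` by a chain
following `f`, where at the critical point `c` the chain may continue with
either `0` or `1`. -/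
def GenBackwardOrbit (f : ℝ → ℝ) (c x : ℝ) : Set ℝ :=
  {y | y ∈ Set.Icc (0:ℝ) 1 ∧ ∃ (k : ℕ) (w : ℕ → ℝ), w 0 = y ∧ w k = x ∧
    ∀ i < k, (w i ≠ c → w (i + 1) = f (w i)) ∧ (w i = c → w (i + 1) = 0 ∨ w (i + 1) = 1)}

/-- A continuous function with nonnegative derivative off a finite set is nondecreasing. -/
theorem le_of_hasDerivAt_nonneg_off_finset (s : Finset ℝ) {g : ℝ → ℝ} {a b : ℝ} (hab : a ≤ b)
    (hg : ContinuousOn g (Set.Icc a b))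
    (hd : ∀ x ∈ Set.Ioo a b, x ∉ s → ∃ d, HasDerivAt g d x ∧ 0 ≤ d) : g a ≤ g b := by
  classical
  induction s using Finset.induction_on generalizing a b with
  | empty =>
    refine monotoneOn_of_deriv_nonneg (convex_Icc a b) hg ?_ ?_ (Set.left_mem_Icc.2 hab)
      (Set.right_mem_Icc.2 hab) hab
    · rw [interior_Icc]
      intro x hx
      obtain ⟨d, h, -⟩ := hd x hx (by simp)
      exact h.differentiableAt.differentiableWithinAt
    · rw [interior_Icc]
      intro x hx
      obtain ⟨d, h, h'⟩ := hd x hx (by simp)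
      rwa [h.deriv]
  | insert p s _ ih =>
    by_cases hp : p ∈ Set.Ioo a b
    · refine (ih hp.1.le (hg.mono (Set.Icc_subset_Icc_right hp.2.le)) ?_).trans
        (ih hp.2.le (hg.mono (Set.Icc_subset_Icc_left hp.1.le)) ?_)
      · intro x hx hxs
        exact hd x ⟨hx.1, hx.2.trans hp.2⟩ (by simp [hxs, hx.2.ne])
      · intro x hx hxs
        exact hd x ⟨hp.1.trans hx.1, hx.2⟩ (by simp [hxs, hx.1.ne'])
    · refine ih hab hg fun x hx hxs => hd x hx ?_
      have : x ≠ p := by rintro rfl; exact hp hx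
      simp [hxs, this]

namespace IsExpandingLorenzOn

variable {f : ℝ → ℝ} {c a b : ℝ}

theorem sub_le_sub (hf : IsExpandingLorenzOn f c a b) {x y : ℝ} (hx : a ≤ x)
    (hxy : x ≤ y) (hy : y ≤ b) (hcont : ContinuousOn f (Set.Icc x y)) : y - x ≤ f y - f x := by
  obtain ⟨F, hF, lam, hlam, hd⟩ := hf.expanding
  have key := le_of_hasDerivAt_nonneg_off_finset hF.toFinset (g := fun t => f t - t) hxy
    (hcont.sub continuousOn_id) (by
      intro t ht htF
      obtain ⟨d, h, h'⟩ := hd t ⟨⟨hx.trans ht.1.le, ht.2.le.trans hy⟩, by simpa using htF⟩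
      have h2 := h.hasDerivAt (Icc_mem_nhds (hx.trans_lt ht.1) (ht.2.trans_le hy))
      exact ⟨d - 1, h2.sub (hasDerivAt_id t), by linarith⟩)
  linarith

theorem continuousOn_Icc_right (hf : IsExpandingLorenzOn f c a b) (hc : f c = a) :
    ContinuousOn f (Set.Icc c b) := by
  intro x hx
  rcases hx.1.eq_or_lt with rfl | hcx
  · refine (continuousWithinAt_Ioi_iff_Ici.1 ?_).mono Set.Icc_subset_Ici_self
    have := hf.lim_right
    rwa [← hc] at this
  · refine ((hf.cont_right x ⟨hcx, hx.2⟩).mono_of_mem_nhdsWithin ?_)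
    filter_upwards [self_mem_nhdsWithin, mem_nhdsWithin_of_mem_nhds (Ioi_mem_nhds hcx)]
      with t ht ht' using ⟨ht', ht.2⟩

theorem lt_of_mem_Ico (hf : IsExpandingLorenzOn f c a b) {x : ℝ} (hx : x ∈ Set.Ico a c) :
    f x < b := by
  obtain ⟨y, hxy, hyc⟩ := exists_between hx.2
  have hy : y ∈ Set.Ico a c := ⟨hx.1.trans hxy.le, hyc⟩
  exact (hf.mono_left hx hy hxy).trans_le (hf.mapsTo ⟨hy.1, hyc.le.trans hf.c_lt_b.le⟩).2

theorem exists_preimage_left (hf : IsExpandingLorenzOn f c a b) {y e : ℝ}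
    (hy : y ∈ Set.Ico a c) (hye : f y < e) (he : e < b) : ∃ x ∈ Set.Ico y c, f x = e := by
  obtain ⟨z, hez, hz⟩ := ((hf.lim_left.eventually (Ioi_mem_nhds he)).and
    (Ioo_mem_nhdsLT hy.2)).exists
  obtain ⟨x, hx, rfl⟩ := intermediate_value_Icc hz.1.le
    (hf.cont_left.mono fun t ht => ⟨hy.1.trans ht.1, ht.2.trans_lt hz.2⟩) ⟨hye.le, le_of_lt hez⟩
  exact ⟨x, ⟨hx.1, hx.2.trans_lt hz.2⟩, rfl⟩

/-- Points lying at distance at least `ε` to the left of a backward invariant set `E` keep this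
property under `f`, provided that `b ∉ E` and that `f b` has this property. -/
theorem separation_invariant (hf : IsExpandingLorenzOn f c a b) (hc : f c = a) {E : Set ℝ}
    (hE : E ⊆ Set.Icc a b) (hpre : Set.Icc a b ∩ f ⁻¹' E ⊆ E) (hb : b ∉ E) {ε : ℝ}
    (hε : ∀ e ∈ E, f b < e → ε ≤ e - f b) {y : ℝ} (hy : y ∈ Set.Icc a b)
    (hyE : ∀ e ∈ E, y < e → ε ≤ e - y) : ∀ e ∈ E, f y < e → ε ≤ e - f y := by
  intro e he hye
  have lift : ∀ x, y ≤ x → x ≤ b → f x = e → ContinuousOn f (Set.Icc y x) → ε ≤ e - f y := by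
    rintro x hyx hxb rfl hcont
    have hlt : y < x := hyx.lt_of_ne (by rintro rfl; exact hye.false)
    have h1 := hyE x (hpre ⟨⟨hy.1.trans hyx, hxb⟩, he⟩) hlt
    have h2 := hf.sub_le_sub hy.1 hyx hxb hcont
    linarith
  rcases lt_or_ge y c with hyc | hcy
  · obtain ⟨x, hx, hfx⟩ := hf.exists_preimage_left ⟨hy.1, hyc⟩ hye
      ((hE he).2.lt_of_ne (by rintro rfl; exact hb he))
    exact lift x hx.1 (hx.2.le.trans hf.c_lt_b.le) hfx
      (hf.cont_left.mono fun t ht => ⟨hy.1.trans ht.1, ht.2.trans_lt hx.2⟩)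
  · have hcont := (hf.continuousOn_Icc_right hc).mono (Set.Icc_subset_Icc_left hcy)
    rcases le_or_gt e (f b) with heb | hbe
    · obtain ⟨x, hx, hfx⟩ := intermediate_value_Icc hy.2 hcont ⟨hye.le, heb⟩
      exact lift x hx.1 hx.2 hfx (hcont.mono (Set.Icc_subset_Icc_right hx.2))
    · have h1 := hε e he hbe
      have h2 := hf.sub_le_sub hy.1 hy.2 le_rfl hcont
      linarith [hy.2]

end IsExpandingLorenzOn

/-- a transitive expanding Lorenz map without fixed points admits no
proper closed completely invariant subset of `[0,1]`. -/
theorem no_proper_completely_invariant_set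
    (f : ℝ → ℝ) (c : ℝ) (hf : IsExpandingLorenz f c) (hc : f c = 0)
    (htrans : LorenzTransitive f) (h0 : f 0 ≠ 0) (h1 : f 1 ≠ 1) :
    ∀ E : Set ℝ, E ⊆ Set.Icc 0 1 → E.Nonempty → IsClosed E →
      f '' E = E → Set.Icc (0:ℝ) 1 ∩ f ⁻¹' E = E → E = Set.Icc (0:ℝ) 1 := by
  intro E hE hne hcl him hpre
  exfalso
  have hf' : IsExpandingLorenzOn f c 0 1 := hf
  have hc1 : c < 1 := hf'.c_lt_b
  have h1m : (1:ℝ) ∈ Set.Icc (0:ℝ) 1 := ⟨zero_le_one, le_rfl⟩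
  have hone : (1:ℝ) ∉ E := by
    intro h
    rw [← him] at h
    obtain ⟨x, hx, hx1⟩ := h
    rcases lt_trichotomy x c with hxc | rfl | hcx
    · exact (hf'.lt_of_mem_Ico ⟨(hE hx).1, hxc⟩).ne hx1
    · rw [hc] at hx1
      exact zero_ne_one hx1
    · have h2 : f x ≤ f 1 := hf'.mono_right.monotoneOn ⟨hcx, (hE hx).2⟩ ⟨hc1, le_rfl⟩ (hE hx).2
      exact h1 (le_antisymm (hf'.mapsTo h1m).2 (hx1 ▸ h2))
  have hf1 : f 1 ∉ E := fun h => hone (hpre ▸ ⟨h1m, h⟩)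
  obtain ⟨ε, hε, hball⟩ := Metric.isOpen_iff.1 hcl.isOpen_compl _ hf1
  obtain ⟨M, hM, hmax⟩ := (isCompact_Icc.of_isClosed_subset hcl hE).exists_isGreatest hne
  have hM1 : M < 1 := (hE hM).2.lt_of_ne (by rintro rfl; exact hone hM)
  have hM0 : 0 < M := by
    refine (hE hM).1.lt_of_ne ?_
    rintro rfl
    have h2 : f 0 ∈ E := him ▸ Set.mem_image_of_mem f hM
    exact h0 (le_antisymm (hmax h2) (hE h2).1)
  have hsep : ∀ e ∈ E, f 1 < e → ε ≤ e - f 1 := by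
    intro e he hlt
    by_contra! h
    exact hball (by rwa [Metric.mem_ball, Real.dist_eq, abs_of_pos (sub_pos.2 hlt)]) he
  have hinv : ∀ n : ℕ, ∀ y ∈ Set.Icc (0:ℝ) 1, M < y →
      f^[n] y ∈ Set.Icc (0:ℝ) 1 ∧ ∀ e ∈ E, f^[n] y < e → ε ≤ e - f^[n] y := by
    intro n y hy hMy
    induction n with
    | zero => exact ⟨hy, fun e he h => absurd (hmax he) (hMy.trans h).not_ge⟩
    | succ n ih =>
      rw [Function.iterate_succ_apply']
      exact ⟨hf'.mapsTo ih.1, hf'.separation_invariant hc hE hpre.subset hone hsep ih.1 ih.2⟩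
  obtain ⟨z, hz⟩ := exists_between (max_lt hM0 (sub_lt_self M hε))
  rw [max_lt_iff] at hz
  obtain ⟨n, -, ⟨y, ⟨hMy, hy⟩, rfl⟩, hV, -⟩ := htrans (Set.Ioi M) (Set.Ioo (M - ε) M) isOpen_Ioi
    isOpen_Ioo ⟨1, hM1, h1m⟩ ⟨z, ⟨hz.1.2, hz.2⟩, hz.1.1.le, (hz.2.trans hM1).le⟩
  linarith [(hinv n y hy hMy).2 M hM hV.2, hV.1]
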